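/- For every complex number s with Re(s) > 1, the Dirichlet series ∑_{n=1}^∞ D(n²)/nˢ converges absolutely and equals ζ(s)² · ∏_p (1 − 1/(2pˢ) + 1/(2p^{2s})), where the product runs over all primes p and ζ denotes the Riemann zeta function. -/

import Mathlib

open Real Finset

/-- `D n = τ(n) / 2^(ω n)`. -/
noncomputable def D (n : ℕ) : ℝ :=
  (n.divisors.card : ℝ) / 2 ^ n.primeFactors.card

/-- `s n` is the smallest nonnegative integer such that `n + s n` is a perfect square. -/
noncomputable def sShift (n : ℕ) : ℕ :=
  sInf {k : ℕ | ∃ m : ℕ, n + k = m ^ 2}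

/-- `P s = ∏_p (1 - 1/(2 p^s) + 1/(2 p^(2 s)))`. -/
noncomputable def P (s : ℝ) : ℝ :=
  ∏' p : Nat.Primes, (1 - 1 / (2 * (p : ℝ) ^ s) + 1 / (2 * (p : ℝ) ^ (2 * s)))

noncomputable def C₁ : ℝ := ∏' p : Nat.Primes, (1 - 1 / (2 * (p : ℝ)) + 1 / (2 * (p : ℝ) ^ 2))

noncomputable def C₂ : ℝ := deriv P 1

/-- `D (n ^ 2)` is at most the number of divisors of `n`. -/
lemma D_sq_le_card_divisors (n : ℕ) : D (n ^ 2) ≤ n.divisors.card := by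
  rcases eq_or_ne n 0 with rfl | hn
  · simp [D]
  rw [D, Nat.card_divisors (pow_ne_zero 2 hn), Nat.card_divisors hn,
    Nat.primeFactors_pow n two_ne_zero, div_le_iff₀ (by positivity)]
  push_cast
  rw [← Finset.prod_const, ← Finset.prod_mul_distrib]
  refine Finset.prod_le_prod (fun p _ => by positivity) fun p _ => ?_
  simp only [Nat.factorization_pow, Finsupp.smul_apply, smul_eq_mul]
  push_cast
  linarith

lemma D_nonneg (n : ℕ) : 0 ≤ D n := by
  unfold D; positivity

lemma D_mul_of_coprime {m n : ℕ} (h : m.Coprime n) : D (m * n) = D m * D n := by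
  simp only [D, h.card_divisors_mul, h.primeFactors_mul,
    Finset.card_union_of_disjoint h.disjoint_primeFactors, pow_add]
  push_cast
  ring

lemma D_prime_pow {p k : ℕ} (hp : p.Prime) (hk : k ≠ 0) : D (p ^ k) = (k + 1) / 2 := by
  rw [D, Nat.primeFactors_prime_pow hk hp, Nat.divisors_prime_pow hp]
  simp

/-- The Dirichlet series of `n ↦ D (n ^ 2)` converges absolutely on `1 < s.re`. -/
lemma summable_norm_D_sq_div_cpow {s : ℂ} (hs : 1 < s.re) :
    Summable fun n : ℕ => ‖(D (n ^ 2) : ℂ) / (n : ℂ) ^ s‖ := by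
  have hζ := ArithmeticFunction.LSeriesSummable_zeta_iff.mpr hs
  refine (hζ.convolution hζ).norm.of_nonneg_of_le (fun _ => norm_nonneg _) fun n => ?_
  rcases eq_or_ne n 0 with rfl | hn
  · simp [D]
  rw [LSeries.term_of_ne_zero hn, norm_div, norm_div]
  gcongr
  have hconv : (LSeries.convolution (fun n => (ArithmeticFunction.zeta n : ℂ))
      (fun n => (ArithmeticFunction.zeta n : ℂ))) n = (n.divisors.card : ℂ) := by
    rw [LSeries.convolution_def]
    beta_reduce
    rw [← Nat.map_div_right_divisors]
    simp only [Finset.sum_map]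
    rw [Finset.card_eq_sum_ones, Nat.cast_sum]
    refine Finset.sum_congr rfl fun d hd => ?_
    have hd0 : d ≠ 0 := (Nat.pos_of_mem_divisors hd).ne'
    have hnd : n / d ≠ 0 := (Nat.div_pos (Nat.divisor_le hd) (Nat.pos_of_ne_zero hd0)).ne'
    change (ArithmeticFunction.zeta d : ℂ) * (ArithmeticFunction.zeta (n / d) : ℂ) = _
    rw [ArithmeticFunction.zeta_apply_ne hd0, ArithmeticFunction.zeta_apply_ne hnd]
    norm_num
  rw [hconv, Complex.norm_natCast, Complex.norm_of_nonneg (D_nonneg _)]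
  exact D_sq_le_card_divisors n

/-- The generating function of `k ↦ D (p ^ (2 * k))` for a prime `p`. -/
lemma tsum_D_prime_pow_sq_mul_pow {p : ℕ} (hp : p.Prime) {x : ℂ} (hx : ‖x‖ < 1) :
    ∑' k : ℕ, (D ((p ^ k) ^ 2) : ℂ) * x ^ k =
      (1 - x)⁻¹ * (1 - x)⁻¹ * (1 - x / 2 + x ^ 2 / 2) := by
  have hx1 : 1 - x ≠ 0 := by
    rw [sub_ne_zero]
    rintro rfl
    simp at hx
  have h := ((hasSum_coe_mul_geometric_of_norm_lt_one hx).add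
    ((hasSum_geometric_of_norm_lt_one hx).mul_left (1 / 2))).add
      (hasSum_ite_eq (0 : ℕ) (1 / 2 : ℂ))
  have heq : (fun k : ℕ => (D ((p ^ k) ^ 2) : ℂ) * x ^ k) = fun k : ℕ =>
      (k : ℂ) * x ^ k + 1 / 2 * x ^ k + if k = 0 then (1 / 2 : ℂ) else 0 := by
    ext k
    rcases eq_or_ne k 0 with rfl | hk
    · norm_num [D]
    · rw [← pow_mul, D_prime_pow hp (mul_ne_zero hk two_ne_zero), if_neg hk]
      push_cast
      ring
  rw [heq, h.tsum_eq]
  field_simp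
  ring

theorem dirichlet_series_D_square (s : ℂ) (hs : 1 < s.re) :
    Summable (fun n : ℕ+ => ‖(D ((n : ℕ) ^ 2) : ℂ) / ((n : ℕ) : ℂ) ^ s‖) ∧
    ∑' n : ℕ+, (D ((n : ℕ) ^ 2) : ℂ) / ((n : ℕ) : ℂ) ^ s =
      riemannZeta s ^ 2 *
        ∏' p : Nat.Primes, (1 - 1 / (2 * (p : ℂ) ^ s) + 1 / (2 * (p : ℂ) ^ (2 * s))) := by
  have hsum := summable_norm_D_sq_div_cpow hs
  refine ⟨hsum.comp_injective PNat.coe_injective, ?_⟩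
  rw [tsum_pnat_eq_tsum_of_eq_zero (f := fun n : ℕ => (D (n ^ 2) : ℂ) / (n : ℂ) ^ s)
    (by simp [D])]
  have hprod := EulerProduct.eulerProduct_hasProd
    (f := fun n : ℕ => (D (n ^ 2) : ℂ) / (n : ℂ) ^ s) (by simp [D])
    (fun {m n} h => by
      rw [mul_pow, D_mul_of_coprime (h.pow 2 2), Nat.cast_mul, Complex.natCast_mul_natCast_cpow]
      push_cast
      rw [mul_div_mul_comm]) hsum (by simp [D])
  have hprimes : Summable fun p : Nat.Primes => ‖(p : ℂ) ^ (-s)‖ :=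
    (summable_riemannZetaSummand hs).comp_injective Nat.Primes.coe_nat_injective
  have hlt (p : Nat.Primes) : ‖(p : ℂ) ^ (-s)‖ < 1 := by
    rw [Complex.norm_natCast_cpow_of_pos p.2.pos, Complex.neg_re]
    exact Real.rpow_lt_one_of_one_lt_of_neg (mod_cast p.2.one_lt) (by linarith)
  have hfactor (p : Nat.Primes) : 1 - 1 / (2 * (p : ℂ) ^ s) + 1 / (2 * (p : ℂ) ^ (2 * s)) =
      1 - (p : ℂ) ^ (-s) / 2 + ((p : ℂ) ^ (-s)) ^ 2 / 2 := by
    rw [Complex.cpow_neg, two_mul s, Complex.cpow_add _ _ (mod_cast p.2.ne_zero)]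
    ring
  have hmul : Multipliable fun p : Nat.Primes =>
      1 - 1 / (2 * (p : ℂ) ^ s) + 1 / (2 * (p : ℂ) ^ (2 * s)) := by
    have h : Summable fun p : Nat.Primes =>
        ‖-((p : ℂ) ^ (-s)) / 2 + ((p : ℂ) ^ (-s)) ^ 2 / 2‖ := by
      refine hprimes.of_nonneg_of_le (fun _ => norm_nonneg _) fun p => ?_
      refine (norm_add_le _ _).trans ?_
      simp only [norm_div, norm_neg, norm_pow, Complex.norm_ofNat]
      nlinarith [norm_nonneg ((p : ℂ) ^ (-s)), hlt p]
    refine (multipliable_one_add_of_summable h).congr fun p => ?_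
    rw [hfactor]
    ring
  have hζ := riemannZeta_eulerProduct_hasProd hs
  rw [pow_two]
  refine hprod.unique ?_
  refine ((hζ.mul hζ).mul hmul.hasProd).congr_fun fun p => ?_
  have hterm (k : ℕ) : (D (((p : ℕ) ^ k) ^ 2) : ℂ) / (((p : ℕ) ^ k : ℕ) : ℂ) ^ s =
      (D (((p : ℕ) ^ k) ^ 2) : ℂ) * ((p : ℂ) ^ (-s)) ^ k := by
    rw [Nat.cast_pow, ← Complex.natCast_cpow_natCast_mul, Complex.cpow_nat_mul, Complex.cpow_neg,
      inv_pow, div_eq_mul_inv]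
  simp only [hterm]
  rw [tsum_D_prime_pow_sq_mul_pow p.2 (hlt p), hfactor]
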